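/- Let G be a countable sofic group and H a σ-co-sofic subgroup of G. Identify H with the subgroup H × {0} of G × ℤ. Then H < G × ℤ is relatively sofic over G × ℤ, and consequently the amalgamated free product ∗_H (G × ℤ) of countably infinitely many copies of G × ℤ amalgamated over H (each copy of H identified via the same inclusion H ↪ G × ℤ) is sofic. -/

import Mathlib

universe u v

/-- Normalized Hamming distance between two permutations of a (finite) type. -/
noncomputable def permDist {A : Type*} (σ τ : Equiv.Perm A) : ℝ :=
  (Set.ncard {a | σ a ≠ τ a} : ℝ) / (Nat.card A : ℝ)

/-- A group is sofic if every finite subset admits `(F, ε)`-approximations by permutations. -/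
def IsSofic (G : Type*) [Group G] : Prop :=
  ∀ (F : Finset G) (ε : ℝ), 0 < ε →
    ∃ A : Type, Finite A ∧ Nonempty A ∧ ∃ φ : G → Equiv.Perm A,
      φ 1 = 1 ∧
      (∀ g ∈ F, ∀ h ∈ F, permDist (φ (g * h)) (φ g * φ h) < ε) ∧
      (∀ g ∈ F, g ≠ 1 → 1 - ε < permDist (φ g) 1)


/-- A group is amenable if it carries a left-invariant finitely additive
probability measure defined on all subsets. -/
def IsAmenable (G : Type*) [Group G] : Prop :=
  ∃ m : Set G → ℝ,
    (∀ A : Set G, 0 ≤ m A) ∧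
    m Set.univ = 1 ∧
    (∀ A B : Set G, Disjoint A B → m (A ∪ B) = m A + m B) ∧
    (∀ (g : G) (A : Set G), m ((g * ·) '' A) = m A)


/-- The subgroup of sequences equal to the identity ω-almost everywhere. -/
def upKer {ι : Type*} (ω : Ultrafilter ι) (G : ι → Type*) [∀ i, Group (G i)] :
    Subgroup (∀ i, G i) where
  carrier := {f | ∀ᶠ i in (ω : Filter ι), f i = 1}
  one_mem' := Filter.Eventually.of_forall fun _ => rfl
  mul_mem' := by
    intro a b ha hb
    filter_upwards [ha, hb] with i h1 h2
    simp [h1, h2]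
  inv_mem' := by
    intro a ha
    filter_upwards [ha] with i h1
    simp [h1]

instance upKer_normal {ι : Type*} (ω : Ultrafilter ι) (G : ι → Type*) [∀ i, Group (G i)] :
    (upKer ω G).Normal := by
  constructor
  intro a ha g
  filter_upwards [ha] with i h1
  simp [h1]

/-- The algebraic ultraproduct of a family of groups along an ultrafilter. -/
def Ultraproduct {ι : Type*} (ω : Ultrafilter ι) (G : ι → Type*) [∀ i, Group (G i)] :=
  (∀ i, G i) ⧸ upKer ω G

instance {ι : Type*} (ω : Ultrafilter ι) (G : ι → Type*) [∀ i, Group (G i)] :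
    Group (Ultraproduct ω G) :=
  QuotientGroup.Quotient.group _

/-- The subgroup `∏_ω H_i` of the algebraic ultraproduct `∏_ω G_i`. -/
def upSubgroup {ι : Type*} (ω : Ultrafilter ι) {G : ι → Type*} [∀ i, Group (G i)]
    (H : ∀ i, Subgroup (G i)) : Subgroup (Ultraproduct ω G) :=
  Subgroup.map (QuotientGroup.mk' (upKer ω G)) (Subgroup.pi Set.univ H)


/-- A witness to relative soficity of `H < G` over `K`. -/
structure RelSoficWitness {G : Type*} [Group G] (H : Subgroup G) (K : Type*) [Group K] where
  Gi : ℕ → Type u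
  [instGi : ∀ i, Group (Gi i)]
  Hi : ∀ i, Subgroup (Gi i)
  ω : Ultrafilter ℕ
  free : ∀ s : Set ℕ, s.Finite → s ∉ ω
  sofic : ∀ i, IsSofic (Gi i)
  amenable : ∀ i, IsAmenable (Hi i)
  π : G →* Ultraproduct ω (fun i => Gi i × K)
  inj : Function.Injective π
  inter : Subgroup.map π ⊤ ⊓ upSubgroup ω (fun i => (Hi i).prod ⊤) = Subgroup.map π H

/-- `H < G` is relatively sofic over `K`. -/
def RelativelySofic {G : Type*} [Group G] (H : Subgroup G) (K : Type*) [Group K] : Prop :=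
  Nonempty (RelSoficWitness.{u} H K)


/-- A witness to co-soficity of the subgroup `H` of `G`. -/
structure CoSoficWitness {G : Type*} [Group G] (H : Subgroup G) where
  Gi : ℕ → Subgroup G
  Hi : ℕ → Subgroup G
  antitone_G : Antitone Gi
  antitone_H : Antitone Hi
  iInf_eq : ⨅ i, Gi i = H
  le : ∀ i, Hi i ≤ Gi i
  [normal : ∀ i, (Hi i).Normal]
  sofic : ∀ i, IsSofic (G ⧸ Hi i)
  amenable : ∀ i, IsAmenable (Gi i ⧸ (Hi i).subgroupOf (Gi i))

/-- The subgroup `H` is co-sofic in `G`. -/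
def CoSofic {G : Type*} [Group G] (H : Subgroup G) : Prop :=
  Nonempty (CoSoficWitness H)


/-- The subgroup `H` is σ-co-sofic in `G`. -/
def SigmaCoSofic {G : Type*} [Group G] (H : Subgroup G) : Prop :=
  ∃ Gi Hi : ℕ → Subgroup G,
    Monotone Gi ∧ Monotone Hi ∧
    (⨆ i, Gi i) = ⊤ ∧ (⨆ i, Hi i) = H ∧
    (∀ i, Hi i ≤ Gi i) ∧
    ∀ i, CoSofic ((Hi i).subgroupOf (Gi i))

/-! ### "Most points" of a finite set -/

def Most {A : Type*} (ε : ℝ) (P : A → Prop) : Prop :=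
  (Set.ncard {a | ¬ P a} : ℝ) ≤ ε * (Nat.card A : ℝ)

theorem Most.mono {A : Type*} [Finite A] {ε δ : ℝ} {P Q : A → Prop} (h : Most ε P)
    (hPQ : ∀ a, P a → Q a) (hε : ε ≤ δ) : Most δ Q := by
  unfold Most at *
  have h1 : Set.ncard {a | ¬ Q a} ≤ Set.ncard {a | ¬ P a} :=
    Set.ncard_le_ncard (fun a ha hp => ha (hPQ a hp)) (Set.toFinite _)
  have h2 : (Set.ncard {a | ¬ Q a} : ℝ) ≤ Set.ncard {a | ¬ P a} := by exact_mod_cast h1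
  have h3 : (0 : ℝ) ≤ Nat.card A := by positivity
  nlinarith

theorem Most.and {A : Type*} [Finite A] {ε δ : ℝ} {P Q : A → Prop} (h : Most ε P)
    (h' : Most δ Q) : Most (ε + δ) (fun a => P a ∧ Q a) := by
  unfold Most at *
  have h1 : Set.ncard {a | ¬ (P a ∧ Q a)} ≤ Set.ncard {a | ¬ P a} + Set.ncard {a | ¬ Q a} := by
    refine le_trans (Set.ncard_le_ncard ?_ (Set.toFinite _)) (Set.ncard_union_le _ _)
    intro a ha
    simp only [Set.mem_ofPred_eq, Set.mem_union] at *
    tauto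
  have h2 : (Set.ncard {a | ¬ (P a ∧ Q a)} : ℝ) ≤
    Set.ncard {a | ¬ P a} + Set.ncard {a | ¬ Q a} := by exact_mod_cast h1
  linarith

theorem Most.forall_finset {A ι : Type*} [Finite A] {ε : ℝ} (s : Finset ι) {P : ι → A → Prop}
    (h : ∀ i ∈ s, Most ε (P i)) : Most (s.card * ε) (fun a => ∀ i ∈ s, P i a) := by
  classical
  induction s using Finset.induction_on with
  | empty => simp [Most]
  | insert i s hi ih =>
    have h1 := (h i (by simp)).and (ih fun j hj => h j (by simp [hj]))
    refine h1.mono ?_ ?_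
    · intro a ha j hj
      rcases Finset.mem_insert.1 hj with rfl | hj
      · exact ha.1
      · exact ha.2 j hj
    · rw [Finset.card_insert_of_notMem hi]; push_cast; linarith

theorem Most.prod {A B : Type*} [Finite A] [Finite B] {ε : ℝ} {P : A × B → Prop}
    (h : ∀ a, Most ε (fun b => P (a, b))) : Most ε P := by
  classical
  have := Fintype.ofFinite A
  unfold Most at *
  have e : Set.ncard {p | ¬ P p} = ∑ a : A, Set.ncard {b | ¬ P (a, b)} := by
    rw [← Nat.card_coe_set_eq]
    have e1 : ({p | ¬ P p} : Set (A × B)) ≃ Σ a : A, ({b | ¬ P (a, b)} : Set B) :=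
      { toFun := fun p => ⟨p.1.1, ⟨p.1.2, p.2⟩⟩
        invFun := fun q => ⟨(q.1, q.2.1), q.2.2⟩
        left_inv := fun _ => rfl
        right_inv := fun _ => rfl }
    rw [Nat.card_congr e1, Nat.card_sigma]
    rfl
  rw [e, Nat.card_prod, Nat.card_eq_fintype_card (α := A)]
  push_cast
  calc ∑ a : A, (Set.ncard {b | ¬ P (a, b)} : ℝ) ≤ ∑ a : A, ε * (Nat.card B : ℝ) :=
        Finset.sum_le_sum fun a _ => h a
    _ = _ := by simp; ring

theorem Most.swap {A B : Type*} [Finite A] [Finite B] {ε : ℝ} {P : A × B → Prop}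
    (h : Most ε P) : Most ε (fun q : B × A => P (q.2, q.1)) := by
  unfold Most at *
  have e : Set.ncard {q : B × A | ¬ P (q.2, q.1)} = Set.ncard {p | ¬ P p} := by
    rw [← Nat.card_coe_set_eq, ← Nat.card_coe_set_eq]
    exact Nat.card_congr
      { toFun := fun q => ⟨(q.1.2, q.1.1), q.2⟩
        invFun := fun q => ⟨(q.1.2, q.1.1), q.2⟩
        left_inv := fun _ => rfl
        right_inv := fun _ => rfl }
  rw [e, Nat.card_prod, mul_comm (Nat.card B), ← Nat.card_prod]
  exact h

theorem Most.snd {A B : Type*} [Finite A] [Finite B] {ε : ℝ} {P : B → Prop}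
    (h : Most ε P) : Most ε (fun q : A × B => P q.2) := Most.prod fun _ => h

theorem Most.fst {A B : Type*} [Finite A] [Finite B] {ε : ℝ} {P : A → Prop}
    (h : Most ε P) : Most ε (fun q : A × B => P q.1) :=
  Most.swap (P := fun q : B × A => P q.2) (Most.snd h)

theorem Most.of_forall {A : Type*} {ε : ℝ} (hε : 0 ≤ ε) {P : A → Prop}
    (h : ∀ a, P a) : Most ε P := by
  unfold Most
  have : {a | ¬ P a} = ∅ := by ext a; simp [h a]
  rw [this]; simp; positivity

/-! ### Reformulating soficity -/

def Good {G A : Type*} [Group G] (φ : G → Equiv.Perm A) (F : Finset G) (a : A) : Prop :=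
  (∀ g ∈ F, ∀ h ∈ F, φ (g * h) a = φ g (φ h a)) ∧ ∀ g ∈ F, ∀ h ∈ F, φ g a = φ h a → g = h

theorem IsSofic.most {G : Type*} [Group G] (hG : IsSofic G) (F : Finset G) (ε : ℝ) (hε : 0 < ε) :
    ∃ A : Type, Finite A ∧ Nonempty A ∧ ∃ φ : G → Equiv.Perm A, Most ε (Good φ F) := by
  classical
  let D : Finset G := (F ×ˢ F).image fun p => p.1⁻¹ * p.2
  let F' : Finset G := F ∪ D
  let N : ℝ := ((F' ×ˢ F').card + F'.card + 1 : ℝ)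
  have hN : 0 < N := by positivity
  obtain ⟨A, hA, hA', φ, -, h2, h3⟩ := hG F' (ε / N) (by positivity)
  refine ⟨A, hA, hA', φ, ?_⟩
  have hc : (0 : ℝ) < Nat.card A := by exact_mod_cast Nat.card_pos
  have m1 : Most ((F' ×ˢ F').card * (ε / N)) (fun a => ∀ p ∈ F' ×ˢ F',
      φ (p.1 * p.2) a = φ p.1 (φ p.2 a)) := by
    apply Most.forall_finset
    rintro ⟨g, h⟩ hp
    rw [Finset.mem_product] at hp
    have := h2 g hp.1 h hp.2
    rw [permDist, div_lt_iff₀ hc] at this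
    exact this.le
  have m2 : Most (F'.card * (ε / N)) (fun a => ∀ g ∈ F', g ≠ 1 → φ g a ≠ a) := by
    apply Most.forall_finset
    intro g hg
    by_cases h1 : g = 1
    · exact Most.of_forall (by positivity) fun a h => absurd h1 h
    have := h3 g hg h1
    rw [permDist, lt_div_iff₀ hc] at this
    have e : {a | ¬ (g ≠ 1 → φ g a ≠ a)} = {a | φ g a ≠ (1 : Equiv.Perm A) a}ᶜ := by
      ext a; simp [h1]
    have e2 := Set.ncard_add_ncard_compl {a | φ g a ≠ (1 : Equiv.Perm A) a}
    have e3 : (Set.ncard {a | φ g a ≠ (1 : Equiv.Perm A) a} : ℝ) +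
      Set.ncard {a | φ g a ≠ (1 : Equiv.Perm A) a}ᶜ = Nat.card A := by exact_mod_cast e2
    unfold Most
    rw [e]
    linarith
  refine (m1.and m2).mono ?_ ?_
  · rintro a ⟨ha, hb⟩
    refine ⟨fun g hg h hh => ha (g, h) (by simp [F', hg, hh]), fun g hg h hh e => ?_⟩
    by_contra hne
    have hd : g⁻¹ * h ∈ F' := Finset.mem_union_right _
      (Finset.mem_image.2 ⟨(g, h), by simp [hg, hh], rfl⟩)
    apply hb _ hd (by rwa [ne_eq, inv_mul_eq_one])
    apply (φ g).injective
    have := ha (g, g⁻¹ * h) (by simp only [Finset.mem_product]; exact ⟨by simp [F', hg], hd⟩)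
    simp only [mul_inv_cancel_left] at this
    rw [← this, e]
  · rw [← add_mul, mul_div_assoc', div_le_iff₀ hN]
    simp only [N]; nlinarith

theorem isSofic_of_most {G : Type*} [Group G]
    (hG : ∀ (F : Finset G) (ε : ℝ), 0 < ε →
      ∃ A : Type, Finite A ∧ Nonempty A ∧ ∃ φ : G → Equiv.Perm A, Most ε (Good φ F)) :
    IsSofic G := by
  classical
  intro F ε hε
  obtain ⟨A, hA, hA', φ, h⟩ := hG (insert 1 F) (ε / 2) (by positivity)
  have hc : (0 : ℝ) < Nat.card A := by exact_mod_cast Nat.card_pos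
  have key : ∀ a, Good φ (insert 1 F) a → φ 1 a = a := by
    intro a ha
    have := ha.1 1 (by simp) 1 (by simp)
    rw [mul_one] at this
    exact ((φ 1).injective this).symm
  let φ' : G → Equiv.Perm A := fun g => if g = 1 then 1 else φ g
  have key2 : ∀ a, Good φ (insert 1 F) a → ∀ g, φ' g a = φ g a := by
    intro a ha g
    by_cases hg : g = 1
    · subst hg; simp [φ', key a ha]
    · simp [φ', hg]
  refine ⟨A, hA, hA', φ', by simp [φ'], ?_, ?_⟩
  · intro g hg h' hh
    have : Most (ε / 2) (fun a => φ' (g * h') a = (φ' g * φ' h') a) := by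
      refine h.mono (fun a ha => ?_) le_rfl
      rw [Equiv.Perm.mul_apply, key2 a ha, key2 a ha]
      by_cases h1 : g = 1
      · subst h1; simp [φ']
      · simp only [φ', h1, if_false]
        exact ha.1 g (by simp [hg]) h' (by simp [hh])
    rw [permDist, div_lt_iff₀ hc]
    unfold Most at this
    simp only [ne_eq]
    nlinarith
  · intro g hg h1
    have : Most (ε / 2) (fun a => φ' g a ≠ (1 : Equiv.Perm A) a) := by
      refine h.mono (fun a ha => ?_) le_rfl
      rw [key2 a ha]
      intro e
      apply h1
      apply ha.2 g (by simp [hg]) 1 (by simp)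
      rw [key a ha, e]; simp
    rw [permDist, lt_div_iff₀ hc]
    unfold Most at this
    have e2 := Set.ncard_add_ncard_compl {a | φ' g a ≠ (1 : Equiv.Perm A) a}
    have e3 : (Set.ncard {a | φ' g a ≠ (1 : Equiv.Perm A) a} : ℝ) +
      Set.ncard {a | φ' g a ≠ (1 : Equiv.Perm A) a}ᶜ = Nat.card A := by exact_mod_cast e2
    have e4 : {a | ¬ (φ' g a ≠ (1 : Equiv.Perm A) a)} = {a | φ' g a ≠ (1 : Equiv.Perm A) a}ᶜ := rfl
    rw [e4] at this
    nlinarith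

theorem IsSofic.of_injective {G H : Type*} [Group G] [Group H] (hH : IsSofic H) (f : G →* H)
    (hf : Function.Injective f) : IsSofic G := by
  classical
  intro F ε hε
  obtain ⟨A, hA, hA', φ, h1, h2, h3⟩ := hH (F.image f) ε hε
  refine ⟨A, hA, hA', fun g => φ (f g), by simpa using h1, ?_, ?_⟩
  · intro g hg h hh
    simp only [map_mul]
    exact h2 _ (Finset.mem_image_of_mem f hg) _ (Finset.mem_image_of_mem f hh)
  · intro g hg h
    exact h3 _ (Finset.mem_image_of_mem f hg) (by rwa [ne_eq, map_eq_one_iff f hf])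

theorem IsSofic.prod {G H : Type*} [Group G] [Group H] (hG : IsSofic G) (hH : IsSofic H) :
    IsSofic (G × H) := by
  classical
  refine isSofic_of_most fun F ε hε => ?_
  obtain ⟨A, hA, hA', φ, h⟩ := hG.most (F.image Prod.fst) (ε / 2) (by positivity)
  obtain ⟨B, hB, hB', ψ, h'⟩ := hH.most (F.image Prod.snd) (ε / 2) (by positivity)
  refine ⟨A × B, inferInstance, inferInstance, fun p => (φ p.1).prodCongr (ψ p.2), ?_⟩
  refine ((Most.fst (B := B) h).and (Most.snd (A := A) h')).mono ?_ (by linarith)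
  rintro ⟨a, b⟩ ⟨ha, hb⟩
  refine ⟨fun g hg h hh => ?_, fun g hg h hh e => ?_⟩
  · have e1 := ha.1 _ (Finset.mem_image_of_mem _ hg) _ (Finset.mem_image_of_mem _ hh)
    have e2 := hb.1 _ (Finset.mem_image_of_mem _ hg) _ (Finset.mem_image_of_mem _ hh)
    simp_all
  · simp only [Equiv.prodCongr_apply, Prod.map_apply, Prod.mk.injEq] at e
    exact Prod.ext
      (ha.2 _ (Finset.mem_image_of_mem _ hg) _ (Finset.mem_image_of_mem _ hh) e.1)
      (hb.2 _ (Finset.mem_image_of_mem _ hg) _ (Finset.mem_image_of_mem _ hh) e.2)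

theorem isSofic_int : IsSofic (Multiplicative ℤ) := by
  classical
  refine isSofic_of_most fun F ε hε => ?_
  let N : ℕ := (∑ k ∈ F, (Multiplicative.toAdd k).natAbs) * 2 + 1
  have : NeZero N := ⟨by simp [N]⟩
  refine ⟨ZMod N, inferInstance, inferInstance,
    fun k => Equiv.addLeft ((Multiplicative.toAdd k : ℤ) : ZMod N),
    Most.of_forall hε.le fun a => ⟨?_, ?_⟩⟩
  · intro g _ h _
    simp
  · intro g hg h hh e
    simp only [Equiv.coe_addLeft, add_left_inj] at e
    rw [ZMod.intCast_eq_intCast_iff_dvd_sub] at e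
    have b1 := Finset.single_le_sum (f := fun k => (Multiplicative.toAdd k).natAbs)
      (fun _ _ => Nat.zero_le _) hg
    have b2 := Finset.single_le_sum (f := fun k => (Multiplicative.toAdd k).natAbs)
      (fun _ _ => Nat.zero_le _) hh
    have := Int.eq_zero_of_abs_lt_dvd e (by
      simp only [N]
      generalize (∑ k ∈ F, (Multiplicative.toAdd k).natAbs) = S at *
      push_cast
      rw [abs_lt]
      omega)
    apply Multiplicative.toAdd.injective
    linarith

/-! ### Amenability and Følner sets -/

theorem IsAmenable.of_surjective {G H : Type*} [Group G] [Group H] (hG : IsAmenable G)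
    (f : G →* H) (hf : Function.Surjective f) : IsAmenable H := by
  obtain ⟨m, h0, h1, h2, h3⟩ := hG
  refine ⟨fun A => m (f ⁻¹' A), fun A => h0 _, by simpa using h1, ?_, ?_⟩
  · intro A B hAB
    beta_reduce
    rw [Set.preimage_union]
    exact h2 _ _ (hAB.preimage f)
  · intro h A
    obtain ⟨g, rfl⟩ := hf h
    beta_reduce
    rw [← h3 g (f ⁻¹' A)]
    congr 1
    ext x
    simp only [Set.image_mul_left, Set.mem_preimage, map_mul, map_inv]

theorem amenable_finset_sum {G ι : Type*} {m : Set G → ℝ}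
    (h2 : ∀ A B : Set G, Disjoint A B → m (A ∪ B) = m A + m B)
    (s : Finset ι) (A : ι → Set G) (hd : ∀ i ∈ s, ∀ j ∈ s, i ≠ j → Disjoint (A i) (A j)) :
    m (⋃ i ∈ s, A i) = ∑ i ∈ s, m (A i) := by
  classical
  induction s using Finset.induction_on with
  | empty =>
    have := h2 ∅ ∅ (by simp)
    simp at this
    simpa using this
  | insert i s hi ih =>
    rw [Finset.set_biUnion_insert, h2, ih, Finset.sum_insert hi]
    · intro j hj k hk
      exact hd j (by simp [hj]) k (by simp [hk])
    · rw [Set.disjoint_iUnion₂_right]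
      intro j hj
      exact hd i (by simp) j (by simp [hj]) (by rintro rfl; exact hi hj)

open scoped Pointwise in
theorem IsAmenable.no_doubling {M : Type*} [Group M] [DecidableEq M] (hM : IsAmenable M)
    (S : Finset M) :
    ∃ T : Finset M, T.Nonempty ∧ (S * T).card < 2 * T.card := by
  by_contra hcon
  push Not at hcon
  obtain ⟨m, h0, h1, h2, h3⟩ := hM
  obtain ⟨f, hf, hfS⟩ := (Finset.all_card_le_biUnion_card_iff_exists_injective
    (fun p : M × Bool => S.image fun s => s * p.1)).1 (by
      intro I
      rcases I.eq_empty_or_nonempty with rfl | hI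
      · simp
      have e1 : I.card ≤ 2 * (I.image Prod.fst).card := by
        have : I ⊆ (I.image Prod.fst) ×ˢ (Finset.univ : Finset Bool) := by
          intro p hp
          simp only [Finset.mem_product, Finset.mem_univ, and_true]
          exact Finset.mem_image_of_mem _ hp
        have := Finset.card_le_card this
        rw [Finset.card_product] at this
        simp only [Finset.card_univ, Fintype.card_bool] at this
        omega
      refine e1.trans ((hcon _ (hI.image _)).trans (Finset.card_le_card ?_))
      intro y hy
      obtain ⟨s, hs, x, hx, rfl⟩ := Finset.mem_mul.1 hy
      obtain ⟨p, hp, rfl⟩ := Finset.mem_image.1 hx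
      exact Finset.mem_biUnion.2 ⟨p, hp, Finset.mem_image.2 ⟨s, hs, rfl⟩⟩)
  let A : M × Bool → Set M := fun q => {x | f (x, q.2) = q.1 * x}
  have hA : ∀ b, ∑ s ∈ S, m (A (s, b)) = 1 := by
    intro b
    rw [← amenable_finset_sum h2, ← h1]
    · congr 1
      ext x
      simp only [Set.mem_iUnion, Set.mem_univ, iff_true]
      obtain ⟨s, hs, e⟩ := Finset.mem_image.1 (hfS (x, b))
      exact ⟨s, hs, e.symm⟩
    · intro s _ s' _ hne
      rw [Set.disjoint_left]
      intro x hx hx'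
      apply hne
      have e1 : f (x, b) = s * x := hx
      have e2 : f (x, b) = s' * x := hx'
      exact mul_right_cancel (e1.symm.trans e2)
  have hle : ∑ q ∈ S ×ˢ (Finset.univ : Finset Bool), m ((q.1 * ·) '' A q) ≤ 1 := by
    rw [← amenable_finset_sum h2]
    · set U := ⋃ i ∈ S ×ˢ (Finset.univ : Finset Bool), (i.1 * ·) '' A i
      have := h2 U Uᶜ disjoint_compl_right
      rw [Set.union_compl_self, h1] at this
      have := h0 Uᶜ
      linarith
    · rintro ⟨s, b⟩ _ ⟨s', b'⟩ _ hne
      rw [Set.disjoint_left]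
      rintro y ⟨x, hx, rfl⟩ ⟨x', hx', e⟩
      apply hne
      have e1 : f (x, b) = s * x := hx
      have e2 : f (x', b') = s' * x' := hx'
      simp only at e
      have e3 := hf (e2.trans (e.trans e1.symm))
      simp only [Prod.mk.injEq] at e3
      obtain ⟨rfl, rfl⟩ := e3
      rw [mul_right_cancel e]
  rw [Finset.sum_congr rfl (fun q _ => h3 q.1 (A q)), Finset.sum_product_right] at hle
  simp only [hA, Finset.sum_const, Finset.card_univ, Fintype.card_bool] at hle
  norm_num at hle

open scoped Pointwise in
theorem IsAmenable.folner {M : Type*} [Group M] [DecidableEq M] (hM : IsAmenable M) (S : Finset M)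
    (δ : ℝ) (hδ : 0 < δ) :
    ∃ T : Finset M, T.Nonempty ∧
      ∀ s ∈ S, ((T.filter fun t => s * t ∉ T).card : ℝ) ≤ δ * T.card := by
  set S' := insert 1 S with hS'
  obtain ⟨T, hT, hc⟩ : ∃ T : Finset M, T.Nonempty ∧ ((S' * T).card : ℝ) ≤ (1 + δ) * T.card := by
    by_contra hcon
    push Not at hcon
    have hne : S'.Nonempty := ⟨1, by simp [hS']⟩
    have hpow : ∀ k : ℕ, ∀ T : Finset M, T.Nonempty →
        (1 + δ) ^ k * T.card ≤ ((S' ^ k * T).card : ℝ) := by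
      intro k
      induction k with
      | zero => intro T _; simp
      | succ k ih =>
        intro T hT
        rw [pow_succ', mul_assoc, pow_succ', mul_assoc]
        refine le_trans ?_ (hcon (S' ^ k * T) (hne.pow.mul hT)).le
        have := ih T hT
        nlinarith
    obtain ⟨k, hk⟩ := pow_unbounded_of_one_lt (2 : ℝ) (by linarith : 1 < 1 + δ)
    obtain ⟨T, hT, h2⟩ := hM.no_doubling (S' ^ k)
    have h3 := hpow k T hT
    have h4 : ((S' ^ k * T).card : ℝ) < 2 * T.card := by exact_mod_cast h2
    have h5 : (0 : ℝ) < T.card := by exact_mod_cast hT.card_pos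
    nlinarith
  refine ⟨T, hT, fun s hs => ?_⟩
  have hsub : T ⊆ S' * T := by
    intro t ht
    exact Finset.mem_mul.2 ⟨1, by simp [hS'], t, ht, one_mul t⟩
  have h1 : (T.filter fun t => s * t ∉ T).card ≤ ((S' * T) \ T).card := by
    apply Finset.card_le_card_of_injOn (fun t => s * t)
    · intro t ht
      simp only [Finset.coe_filter, Set.mem_ofPred_eq] at ht
      simp only [Finset.coe_sdiff, Set.mem_sdiff, Finset.mem_coe]
      exact ⟨Finset.mul_mem_mul (by simp [hS', hs]) ht.1, ht.2⟩
    · intro a _ b _ e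
      exact mul_left_cancel e
  have h2 := Finset.card_sdiff_add_card_eq_card hsub
  have h3 : (((S' * T) \ T).card : ℝ) + T.card = (S' * T).card := by exact_mod_cast h2
  have h4 : ((T.filter fun t => s * t ∉ T).card : ℝ) ≤ ((S' * T) \ T).card := by exact_mod_cast h1
  linarith

/-! ### Min-hashing -/

theorem most_argmin {A : Type*} [Finite A] [DecidableEq A] (R D : Finset A) (hR : R.Nonempty)
    (hD : D ⊆ R) (δ : ℝ) (hδ : (D.card : ℝ) ≤ δ * R.card) :
    Most δ (fun u : A ≃ Fin (Nat.card A) => ∃ x ∈ R, x ∉ D ∧ ∀ y ∈ R, u x ≤ u y) := by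
  classical
  let Z : A → Set (A ≃ Fin (Nat.card A)) := fun x => {u | ∀ y ∈ R, u x ≤ u y}
  have hsw : ∀ x ∈ R, ∀ y ∈ R, (Z x).ncard ≤ (Z y).ncard := by
    intro x hx y hy
    apply Set.ncard_le_ncard_of_injOn (fun u => (Equiv.swap x y).trans u)
    · intro u hu z hz
      simp only [Equiv.trans_apply, Equiv.swap_apply_right]
      apply hu
      rcases eq_or_ne z x with rfl | h1
      · simpa using hy
      rcases eq_or_ne z y with rfl | h2
      · simpa using hx
      rwa [Equiv.swap_apply_of_ne_of_ne h1 h2]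
    · intro u _ v _ e
      ext z
      have := DFunLike.congr_fun e (Equiv.swap x y z)
      simp only [Equiv.trans_apply, Equiv.swap_apply_self] at this
      rw [this]
  obtain ⟨x0, hx0⟩ := hR
  have heq : ∀ x ∈ R, (Z x).ncard = (Z x0).ncard := fun x hx =>
    le_antisymm (hsw x hx x0 hx0) (hsw x0 hx0 x hx)
  have hsum : R.card * (Z x0).ncard ≤ Nat.card (A ≃ Fin (Nat.card A)) := by
    have := Fintype.ofFinite (A ≃ Fin (Nat.card A))
    have e1 : R.card * (Z x0).ncard = ∑ x ∈ R, (Z x).toFinset.card := by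
      rw [Finset.sum_congr rfl (fun x hx => (Set.ncard_eq_toFinset_card' (Z x)).symm.trans (heq x hx))]
      simp
    rw [e1, ← Finset.card_biUnion, Nat.card_eq_fintype_card (α := A ≃ Fin (Nat.card A))]
    · exact Finset.card_le_univ _
    · intro x hx y hy hne
      rw [Function.onFun, Finset.disjoint_left]
      intro u hu hv
      simp only [Set.mem_toFinset] at hu hv
      exact hne (u.injective (le_antisymm (hu y hy) (hv x hx)))
  have hbad : Set.ncard {u : A ≃ Fin (Nat.card A) | ¬ ∃ x ∈ R, x ∉ D ∧ ∀ y ∈ R, u x ≤ u y} ≤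
      D.card * (Z x0).ncard := by
    have hs : {u : A ≃ Fin (Nat.card A) | ¬ ∃ x ∈ R, x ∉ D ∧ ∀ y ∈ R, u x ≤ u y} ⊆
        ⋃ x ∈ D, Z x := by
      intro u hu
      obtain ⟨x, hx, hmin⟩ := Finset.exists_min_image R u ⟨x0, hx0⟩
      simp only [Set.mem_iUnion]
      refine ⟨x, ?_, hmin⟩
      by_contra hxD
      exact hu ⟨x, hx, hxD, hmin⟩
    refine (Set.ncard_le_ncard hs (Set.toFinite _)).trans ?_
    refine (Finset.set_ncard_biUnion_le D Z).trans ?_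
    rw [Finset.sum_congr rfl (fun x hx => heq x (hD hx))]
    simp
  unfold Most
  have hR0 : (0 : ℝ) < R.card := by exact_mod_cast Finset.card_pos.2 ⟨x0, hx0⟩
  have hbad' : (Set.ncard {u : A ≃ Fin (Nat.card A) | ¬ ∃ x ∈ R, x ∉ D ∧ ∀ y ∈ R, u x ≤ u y} : ℝ) ≤
      D.card * (Z x0).ncard := by exact_mod_cast hbad
  have hsum' : (R.card : ℝ) * (Z x0).ncard ≤ Nat.card (A ≃ Fin (Nat.card A)) := by
    exact_mod_cast hsum
  have hδ0 : 0 ≤ δ := by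
    by_contra hneg
    have : (0 : ℝ) ≤ D.card := by positivity
    nlinarith
  calc _ ≤ _ := hbad'
    _ ≤ δ * R.card * (Z x0).ncard := by gcongr
    _ = δ * (R.card * (Z x0).ncard) := by ring
    _ ≤ _ := by gcongr

noncomputable def minHash {A : Type*} {n : ℕ} (u : A ≃ Fin n) (P : Finset A) : WithTop (Fin n) :=
  P.inf fun x => ((u x : Fin n) : WithTop (Fin n))

theorem minHash_eq_of {A : Type*} {n : ℕ} (u : A ≃ Fin n) (P : Finset A) (x : A) (hx : x ∈ P)
    (h : ∀ y ∈ P, u x ≤ u y) : minHash u P = (u x : WithTop (Fin n)) :=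
  le_antisymm (Finset.inf_le (f := fun x => ((u x : Fin n) : WithTop (Fin n))) hx)
    (Finset.le_inf fun y hy => WithTop.coe_le_coe.2 (h y hy))

theorem minHash_ne {A : Type*} {n : ℕ} (u : A ≃ Fin n) (P Q : Finset A) (hP : P.Nonempty)
    (hQ : Q.Nonempty) (h : minHash u P = minHash u Q) : ∃ x ∈ P, x ∈ Q := by
  obtain ⟨x, hx, hx'⟩ := Finset.exists_min_image P u hP
  obtain ⟨y, hy, hy'⟩ := Finset.exists_min_image Q u hQ
  rw [minHash_eq_of u P x hx hx', minHash_eq_of u Q y hy hy', WithTop.coe_inj] at h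
  obtain rfl := u.injective h
  exact ⟨x, hx, hy⟩

theorem most_minHash {A : Type*} [Finite A] [DecidableEq A] (P Q : Finset A) (hP : P.Nonempty)
    (hc : P.card = Q.card)
    (δ : ℝ) (hδ : ((P \ Q).card : ℝ) ≤ δ * P.card) :
    Most (2 * δ) (fun u : A ≃ Fin (Nat.card A) => minHash u P = minHash u Q) := by
  have h0 : (P.card : ℝ) ≤ (P ∪ Q).card := by
    exact_mod_cast Finset.card_le_card Finset.subset_union_left
  have hδ0 : 0 ≤ δ := by
    by_contra hneg
    have : (0 : ℝ) ≤ (P \ Q).card := by positivity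
    have : (0 : ℝ) < P.card := by exact_mod_cast hP.card_pos
    nlinarith
  have hc1 : (P \ Q).card = (Q \ P).card := Finset.card_sdiff_comm hc
  refine (most_argmin (P ∪ Q) ((P \ Q) ∪ (Q \ P)) (hP.mono Finset.subset_union_left) ?_
    (2 * δ) ?_).mono ?_ le_rfl
  · intro x; simp only [Finset.mem_union, Finset.mem_sdiff]; tauto
  · have h1 : (((P \ Q) ∪ (Q \ P)).card : ℝ) ≤ (P \ Q).card + (Q \ P).card := by
      exact_mod_cast Finset.card_union_le _ _
    rw [← hc1] at h1
    nlinarith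
  · rintro u ⟨x, hx, hxD, hmin⟩
    simp only [Finset.mem_union, Finset.mem_sdiff] at hx hxD hmin
    rw [minHash_eq_of u P x (by tauto) fun y hy => hmin y (Or.inl hy),
      minHash_eq_of u Q x (by tauto) fun y hy => hmin y (Or.inr hy)]

/-! ### Coset labellings -/

theorem IsAmenable.folner_subgroup {K : Type*} [Group K] [DecidableEq K] (M : Subgroup K)
    (hM : IsAmenable M) (D : Finset K) (δ : ℝ) (hδ : 0 < δ) :
    ∃ U : Finset K, U.Nonempty ∧ (∀ u ∈ U, u ∈ M) ∧
      ∀ m ∈ D, m ∈ M → ((U.filter fun u => u * m ∉ U).card : ℝ) ≤ δ * U.card := by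
  classical
  obtain ⟨T, hT, h⟩ := hM.folner ((D.subtype (· ∈ M)).image fun m => m⁻¹) δ hδ
  have hinj : Function.Injective (fun t : M => (t : K)⁻¹) := fun a b e =>
    Subtype.ext (inv_injective e)
  refine ⟨T.image fun t : M => (t : K)⁻¹, hT.image _, ?_, ?_⟩
  · intro u hu
    obtain ⟨t, -, rfl⟩ := Finset.mem_image.1 hu
    exact M.inv_mem t.2
  · intro m hm hmM
    have := h (⟨m, hmM⟩⁻¹) (Finset.mem_image.2 ⟨⟨m, hmM⟩, by simpa using hm, rfl⟩)
    rw [Finset.card_image_of_injective _ hinj, Finset.filter_image,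
      Finset.card_image_of_injective _ hinj]
    refine le_trans ?_ this
    norm_cast
    apply Finset.card_le_card
    intro t ht
    simp only [Finset.mem_filter] at ht ⊢
    refine ⟨ht.1, fun h' => ht.2 ?_⟩
    refine Finset.mem_image.2 ⟨_, h', ?_⟩
    simp

open scoped Pointwise in
theorem coset_labelling {K : Type*} [Group K] (hK : IsSofic K) (M : Subgroup K)
    (hM : IsAmenable M) (F V : Finset K) (ε : ℝ) (hε : 0 < ε) :
    ∃ A : Type, Finite A ∧ Nonempty A ∧ ∃ (B : Type) (φ : K → Equiv.Perm A) (c : A → K → B),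
      Most ε (fun a => (∀ g ∈ F, ∀ h ∈ F, φ (g * h) a = φ g (φ h a)) ∧
        (∀ g ∈ F, ∀ v ∈ V, ∀ w ∈ V, w * g * v⁻¹ ∈ M → c (φ g a) w = c a v) ∧
        (∀ v ∈ V, ∀ w ∈ V, c a v = c a w → w * v⁻¹ ∈ M)) := by
  classical
  let I : Finset (K × K × K) := F ×ˢ V ×ˢ V
  let δ : ℝ := ε / (4 * (I.card + 1))
  have hδ : 0 < δ := by positivity
  obtain ⟨U, hU, hUM, hUD⟩ := hM.folner_subgroup M (I.image fun p => p.2.2 * p.1 * p.2.1⁻¹) δ hδ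
  let F' : Finset K := F ∪ (U * V) ∪ (U * V * F)
  obtain ⟨A, hA, hA', φ, hφ⟩ := hK.most F' (ε / 2) (by positivity)
  let P : A → K → Finset A := fun a v => U.image fun u => φ (u * v) a
  have hF : ∀ g ∈ F, g ∈ F' := fun g hg => by simp [F', hg]
  have hUV : ∀ u ∈ U, ∀ v ∈ V, u * v ∈ F' := fun u hu v hv =>
    Finset.mem_union_left _ (Finset.mem_union_right _ (Finset.mul_mem_mul hu hv))
  have hUVF : ∀ u ∈ U, ∀ v ∈ V, ∀ g ∈ F, u * v * g ∈ F' := fun u hu v hv g hg =>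
    Finset.mem_union_right _ (Finset.mul_mem_mul (Finset.mul_mem_mul hu hv) hg)
  have hPc : ∀ a, Good φ F' a → ∀ v ∈ V, (P a v).card = U.card := by
    intro a ha v hv
    apply Finset.card_image_of_injOn
    intro u hu u' hu' e
    exact mul_right_cancel (ha.2 _ (hUV u hu v hv) _ (hUV u' hu' v hv) e)
  let Ω := A ≃ Fin (Nat.card A)
  have hΩ : Nonempty Ω := ⟨Finite.equivFin A⟩
  refine ⟨A × Ω, inferInstance, inferInstance, WithTop (Fin (Nat.card A)),
    fun g => (φ g).prodCongr (Equiv.refl _), fun a v => minHash a.2 (P a.1 v), ?_⟩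
  have m2 : Most (I.card * (2 * δ)) (fun a : A × Ω => ∀ p ∈ I, Good φ F' a.1 →
      p.2.2 * p.1 * p.2.1⁻¹ ∈ M →
        minHash a.2 (P (φ p.1 a.1) p.2.2) = minHash a.2 (P a.1 p.2.1)) := by
    apply Most.forall_finset
    rintro ⟨g, v, w⟩ hp
    have hD := hUD _ (Finset.mem_image_of_mem _ hp)
    simp only [I, Finset.mem_product] at hp hD
    obtain ⟨hg, hv, hw⟩ := hp
    apply Most.prod
    intro a
    by_cases ha : Good φ F' a
    swap
    · exact Most.of_forall (by positivity) fun _ h => absurd h ha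
    by_cases hm : w * g * v⁻¹ ∈ M
    swap
    · exact Most.of_forall (by positivity) fun _ _ h => absurd h hm
    have hQ : P (φ g a) w = U.image fun u => φ (u * w * g) a := by
      apply Finset.image_congr
      intro u hu
      exact (ha.1 _ (hUV u hu w hw) _ (hF g hg)).symm
    have hQc : (P (φ g a) w).card = U.card := by
      rw [hQ]
      apply Finset.card_image_of_injOn
      intro u hu u' hu' e
      exact mul_right_cancel (mul_right_cancel
        (ha.2 _ (hUVF u hu w hw g hg) _ (hUVF u' hu' w hw g hg) e))
    refine (most_minHash (P (φ g a) w) (P a v) (hU.image _) (hQc.trans (hPc a ha v hv).symm) δ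
      ?_).mono (fun u hu _ _ => hu) le_rfl
    rw [hQc]
    refine le_trans ?_ (hD hm)
    norm_cast
    refine (Finset.card_le_card ?_).trans (Finset.card_image_le (f := fun u => φ (u * w * g) a))
    intro x hx
    rw [Finset.mem_sdiff, hQ, Finset.mem_image] at hx
    obtain ⟨⟨u, hu, rfl⟩, hx⟩ := hx
    refine Finset.mem_image.2 ⟨u, Finset.mem_filter.2 ⟨hu, fun h => hx ?_⟩, rfl⟩
    refine Finset.mem_image.2 ⟨_, h, ?_⟩
    congr 2
    group
  refine ((Most.fst (B := Ω) hφ).and m2).mono ?_ ?_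
  · rintro ⟨a, u⟩ ⟨ha, hb⟩
    refine ⟨?_, ?_, ?_⟩
    · intro g hg h hh
      have := ha.1 g (hF g hg) h (hF h hh)
      simp only [Equiv.prodCongr_apply, Prod.map_apply, this, Equiv.refl_apply]
    · intro g hg v hv w hw hm
      exact hb (g, v, w) (by simp [I, hg, hv, hw]) ha hm
    · intro v hv w hw e
      obtain ⟨x, hx, hx'⟩ := minHash_ne u _ _ (hU.image _) (hU.image _) e
      obtain ⟨y, hy, rfl⟩ := Finset.mem_image.1 hx
      obtain ⟨z, hz, e⟩ := Finset.mem_image.1 hx'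
      have := ha.2 _ (hUV z hz w hw) _ (hUV y hy v hv) e
      have e3 : w * v⁻¹ = z⁻¹ * y := by
        rw [mul_inv_eq_iff_eq_mul, mul_assoc, ← this]; group
      rw [e3]
      exact M.mul_mem (M.inv_mem (hUM z hz)) (hUM y hy)
  · have : (I.card : ℝ) * (2 * δ) ≤ ε / 2 := by
      simp only [δ]
      rw [mul_div_assoc', mul_div_assoc', div_le_iff₀ (by positivity)]
      nlinarith
    linarith

/-! ### Sofic actions on coset spaces -/

/-- sofic actions -/
def SoficAction (G X : Type*) [Group G] [MulAction G X] : Prop :=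
  ∀ (F : Finset G) (E : Finset X) (ε : ℝ), 0 < ε →
    ∃ A : Type, Finite A ∧ Nonempty A ∧ ∃ (B : Type) (φ : G → Equiv.Perm A) (p : A → X → B),
      Most ε (fun a => Good φ F a ∧ (∀ g ∈ F, ∀ x ∈ E, p (φ g a) (g • x) = p a x) ∧
        Set.InjOn (p a) E)

theorem soficAction_coset {G : Type*} [Group G] (hG : IsSofic G) (H : Subgroup G)
    {K : ℕ → Type*} [∀ i, Group (K i)] (M : ∀ i, Subgroup (K i)) (hK : ∀ i, IsSofic (K i))
    (hM : ∀ i, IsAmenable (M i)) (ψ : ∀ i, G → K i)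
    (h1 : ∀ g h, ∀ᶠ i in Filter.atTop, ψ i (g * h) = ψ i g * ψ i h)
    (h2 : ∀ g, ∀ᶠ i in Filter.atTop, (ψ i g ∈ M i ↔ g ∈ H)) :
    SoficAction G (G ⧸ H) := by
  classical
  intro F E ε hε
  let k : G ⧸ H → G := Quotient.out
  have hk : ∀ x, (k x : G ⧸ H) = x := fun x => Quotient.out_eq x
  have hone : ∀ᶠ i in Filter.atTop, ψ i 1 = 1 := by
    filter_upwards [h1 1 1] with i hi
    rw [mul_one] at hi
    exact left_eq_mul.1 hi
  have hinv : ∀ g, ∀ᶠ i in Filter.atTop, ψ i g⁻¹ = (ψ i g)⁻¹ := by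
    intro g
    filter_upwards [h1 g⁻¹ g, hone] with i hi hi'
    rw [inv_mul_cancel, hi'] at hi
    exact eq_inv_of_mul_eq_one_left hi.symm
  have ev1 : ∀ᶠ i in Filter.atTop, ∀ g ∈ F, ∀ h ∈ F, ψ i (g * h) = ψ i g * ψ i h := by
    simp only [Filter.eventually_all_finset]
    exact fun g _ h _ => h1 g h
  have ev2 : ∀ᶠ i in Filter.atTop, ∀ g ∈ F, ∀ x ∈ E,
      (ψ i (k (g • x)))⁻¹ * ψ i g * ((ψ i (k x))⁻¹)⁻¹ ∈ M i := by
    simp only [Filter.eventually_all_finset]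
    intro g _ x _
    filter_upwards [h1 (k (g • x))⁻¹ g, h1 ((k (g • x))⁻¹ * g) (k x), hinv (k (g • x)),
      h2 ((k (g • x))⁻¹ * g * k x)] with i a1 a2 a3 a4
    rw [inv_inv, ← a3, ← a1, ← a2, a4, mul_assoc, ← QuotientGroup.eq, hk]
    conv_lhs => rw [← hk x]
    rfl
  have ev3 : ∀ᶠ i in Filter.atTop, ∀ x ∈ E, ∀ y ∈ E,
      (ψ i (k y))⁻¹ * ((ψ i (k x))⁻¹)⁻¹ ∈ M i → x = y := by
    simp only [Filter.eventually_all_finset]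
    intro x _ y _
    filter_upwards [h1 (k y)⁻¹ (k x), hinv (k y), h2 ((k y)⁻¹ * k x)] with i a1 a2 a3
    rw [inv_inv, ← a2, ← a1, a3, ← QuotientGroup.eq, hk, hk]
    exact Eq.symm
  obtain ⟨i, e1, e2, e3⟩ := (ev1.and (ev2.and ev3)).exists
  let E' : Finset (G ⧸ H) := E ∪ (F ×ˢ E).image fun p => p.1 • p.2
  obtain ⟨A, hA, hA', φ, hφ⟩ := hG.most F (ε / 2) (by positivity)
  obtain ⟨A₂, hA₂, hA₂', B, θ, c, hc⟩ := coset_labelling (hK i) (M i) (hM i) (F.image (ψ i))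
    (E'.image fun x => (ψ i (k x))⁻¹) (ε / 2) (by positivity)
  refine ⟨A × A₂, inferInstance, inferInstance, B, fun g => (φ g).prodCongr (θ (ψ i g)),
    fun a x => c a.2 (ψ i (k x))⁻¹, ?_⟩
  refine ((Most.fst (B := A₂) hφ).and (Most.snd (A := A) hc)).mono ?_ (by linarith)
  rintro ⟨a, b⟩ ⟨ha, hb1, hb2, hb3⟩
  have hE : ∀ x ∈ E, (ψ i (k x))⁻¹ ∈ E'.image fun x => (ψ i (k x))⁻¹ := fun x hx =>
    Finset.mem_image_of_mem _ (Finset.mem_union_left _ hx)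
  refine ⟨⟨?_, ?_⟩, ?_, ?_⟩
  · intro g hg h hh
    have a1 := ha.1 g hg h hh
    have a2 := hb1 _ (Finset.mem_image_of_mem _ hg) _ (Finset.mem_image_of_mem _ hh)
    rw [← e1 g hg h hh] at a2
    simp only [Equiv.prodCongr_apply, Prod.map_apply, a1, a2]
  · intro g hg h hh e
    exact ha.2 g hg h hh (congrArg Prod.fst e)
  · intro g hg x hx
    refine hb2 _ (Finset.mem_image_of_mem _ hg) _ (hE x hx) _
      (Finset.mem_image_of_mem (fun x => (ψ i (k x))⁻¹)
        (Finset.mem_union_right _ (Finset.mem_image.2 ⟨(g, x), by simp [hg, hx], rfl⟩)))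
      (e2 g hg x hx)
  · intro x hx y hy e
    exact e3 x hx y hy (hb3 _ (hE x hx) _ (hE y hy) e)

theorem exists_perm_extend {n : ℕ} (R : Fin n → Fin n → Prop)
    (hf : ∀ p q q', R p q → R p q' → q = q') (hi : ∀ p p' q, R p q → R p' q → p = p') :
    ∃ σ : Equiv.Perm (Fin n), ∀ p q, R p q → σ p = q := by
  classical
  let f : {p // ∃ q, R p q} → Fin n := fun p => p.2.choose
  have hfs : ∀ p : {p // ∃ q, R p q}, R p (f p) := fun p => p.2.choose_spec
  have hinj : Function.Injective f := by
    intro p p' h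
    apply Subtype.ext
    have h1 := hfs p
    rw [h] at h1
    exact hi _ _ _ h1 (hfs p')
  let e : {p // ∃ q, R p q} ≃ {q // q ∈ Set.range f} := Equiv.ofInjective f hinj
  refine ⟨e.extendSubtype, fun p q hpq => ?_⟩
  rw [Equiv.extendSubtype_apply_of_mem e p ⟨q, hpq⟩]
  exact hf _ _ _ (hfs ⟨p, ⟨q, hpq⟩⟩) hpq

theorem freeGroup_residuallyFinite {α : Type*} (w : FreeGroup α) (hw : w ≠ 1) :
    ∃ (n : ℕ) (f : FreeGroup α →* Equiv.Perm (Fin n)), f w ≠ 1 := by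
  classical
  set L := w.toWord with hL
  set k := L.length with hk
  have hred : ∀ (j : ℕ) (h : j + 1 < k), (L[j]).1 = (L[j+1]).1 → (L[j]).2 = (L[j+1]).2 := by
    have := FreeGroup.isReduced_toWord (x := w)
    exact List.isChain_iff_getElem.1 this
  let R : α → Fin (k+1) → Fin (k+1) → Prop := fun x p q =>
    ∃ (j : ℕ) (h : j < k), (L[j] = (x, true) ∧ p.1 = j + 1 ∧ q.1 = j) ∨
      (L[j] = (x, false) ∧ p.1 = j ∧ q.1 = j + 1)
  have hσ : ∀ x, ∃ σ : Equiv.Perm (Fin (k+1)), ∀ p q, R x p q → σ p = q := by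
    intro x
    apply exists_perm_extend
    · rintro p q q' ⟨j, hj, h⟩ ⟨j', hj', h'⟩
      apply Fin.ext
      rcases h with ⟨h1, h2, h3⟩ | ⟨h1, h2, h3⟩ <;> rcases h' with ⟨h1', h2', h3'⟩ | ⟨h1', h2', h3'⟩
      · omega
      · have e : j' = j + 1 := by omega
        subst e
        have := hred j hj'
        simp [h1, h1'] at this
      · have e : j = j' + 1 := by omega
        subst e
        have := hred j' hj
        simp [h1, h1'] at this
      · omega
    · rintro p q q' ⟨j, hj, h⟩ ⟨j', hj', h'⟩
      apply Fin.ext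
      rcases h with ⟨h1, h2, h3⟩ | ⟨h1, h2, h3⟩ <;> rcases h' with ⟨h1', h2', h3'⟩ | ⟨h1', h2', h3'⟩
      · omega
      · have e : j = j' + 1 := by omega
        subst e
        have := hred j' hj
        simp [h1, h1'] at this
      · have e : j' = j + 1 := by omega
        subst e
        have := hred j hj'
        simp [h1, h1'] at this
      · omega
  choose σ hσ using hσ
  refine ⟨k + 1, FreeGroup.lift σ, fun h1 => ?_⟩
  have key : ∀ (d j : ℕ) (hj : j + d = k), FreeGroup.lift σ (FreeGroup.mk (L.drop j)) (Fin.last k)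
      = ⟨j, by omega⟩ := by
    intro d
    induction d with
    | zero =>
      intro j hj
      have : L.drop j = [] := by
        apply List.drop_eq_nil_of_le
        omega
      rw [this]
      simp [← FreeGroup.one_eq_mk, Fin.ext_iff]
      omega
    | succ d ih =>
      intro j hj
      have hjk : j < k := by omega
      have e : L.drop j = [L[j]] ++ L.drop (j+1) := by
        simp
      rw [e, ← FreeGroup.mul_mk, map_mul, Equiv.Perm.mul_apply, ih (j+1) (by omega)]
      rcases hx : L[j] with ⟨x, b⟩
      cases b
      · have := hσ x ⟨j, by omega⟩ ⟨j+1, by omega⟩ ⟨j, hjk, Or.inr ⟨hx, rfl, rfl⟩⟩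
        simp only [FreeGroup.lift_mk, List.map_cons, List.map_nil, List.prod_singleton, cond_false]
        rw [← this]
        exact Equiv.symm_apply_apply _ _
      · have := hσ x ⟨j+1, by omega⟩ ⟨j, by omega⟩ ⟨j, hjk, Or.inl ⟨hx, rfl, rfl⟩⟩
        simp only [FreeGroup.lift_mk, List.map_cons, List.map_nil, List.prod_singleton, cond_true]
        exact this
  have h2 := key k 0 (by omega)
  rw [List.drop_zero, hL, FreeGroup.mk_toWord, h1] at h2
  have h3 : k = 0 := by
    have := congrArg Fin.val h2
    simpa using this
  exact hw (FreeGroup.toWord_eq_nil_iff.1 (List.length_eq_zero_iff.1 h3))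

theorem freeGroup_residuallyFinite_finset {α : Type} (W : Finset (FreeGroup α)) :
    ∃ (Q : Type) (_ : Group Q) (_ : Finite Q) (f : FreeGroup α →* Q),
      ∀ w ∈ W, w ≠ 1 → f w ≠ 1 := by
  classical
  have h : ∀ w : FreeGroup α, ∃ (n : ℕ) (f : FreeGroup α →* Equiv.Perm (Fin n)), w ≠ 1 → f w ≠ 1 := by
    intro w
    by_cases hw : w = 1
    · exact ⟨0, 1, fun h => absurd hw h⟩
    · obtain ⟨n, f, hf⟩ := freeGroup_residuallyFinite w hw
      exact ⟨n, f, fun _ => hf⟩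
  choose n f hf using h
  refine ⟨∀ i : W, Equiv.Perm (Fin (n i.1)), inferInstance, inferInstance,
    MonoidHom.pi (fun i : W => f i.1), fun w hw hw1 h => ?_⟩
  exact hf w hw1 (congrFun h ⟨w, hw⟩)

theorem freeGroup_map_congr {α β : Type*} [DecidableEq α] (f g : α → β) (w : FreeGroup α)
    (h : ∀ x ∈ w.toWord, f x.1 = g x.1) : FreeGroup.map f w = FreeGroup.map g w := by
  rw [← FreeGroup.mk_toWord (x := w), FreeGroup.map.mk, FreeGroup.map.mk]
  congr 1
  apply List.map_congr_left
  intro x hx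
  rw [h x hx]

theorem freeGroup_map_injOn {α β : Type*} [DecidableEq α] (f : α → β) (w w' : FreeGroup α)
    (s : Set α) (hf : Set.InjOn f s)
    (h : ∀ x ∈ w.toWord, x.1 ∈ s) (h' : ∀ x ∈ w'.toWord, x.1 ∈ s)
    (e : FreeGroup.map f w = FreeGroup.map f w') : w = w' := by
  rcases isEmpty_or_nonempty α with hα | hα
  · exact Subsingleton.elim _ _
  have key : ∀ v : FreeGroup α, (∀ x ∈ v.toWord, x.1 ∈ s) →
      FreeGroup.map (Function.invFunOn f s) (FreeGroup.map f v) = v := by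
    intro v hv
    rw [FreeGroup.map.comp]
    conv_rhs => rw [← FreeGroup.map.id v]
    apply freeGroup_map_congr
    intro x hx
    exact hf.leftInvOn_invFunOn (hv x hx)
  rw [← key w h, e, key w' h']

/-- The action of `G` on the free group over `X × ℕ`. -/
def actHom (G X : Type*) [Group G] [MulAction G X] : G →* MulAut (FreeGroup (X × ℕ)) where
  toFun g := FreeGroup.freeGroupCongr ((MulAction.toPerm g).prodCongr (Equiv.refl ℕ))
  map_one' := by
    ext w
    simp only [FreeGroup.freeGroupCongr_apply, MulAut.one_apply]
    conv_rhs => rw [← FreeGroup.map.id w]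
    congr 1
    congr 1
    funext x
    exact Prod.ext (one_smul G x.1) rfl
  map_mul' g h := by
    ext w
    simp only [FreeGroup.freeGroupCongr_apply, MulAut.mul_apply]
    rw [FreeGroup.map.comp]
    congr 1
    congr 1
    funext x
    exact Prod.ext (mul_smul g h x.1) rfl

theorem actHom_apply {G X : Type*} [Group G] [MulAction G X] (g : G) (w : FreeGroup (X × ℕ)) :
    actHom G X g w = FreeGroup.map (fun x => (g • x.1, x.2)) w := rfl

theorem isSofic_semidirect {G X : Type*} [Group G] [MulAction G X] (hS : SoficAction G X) :
    IsSofic (FreeGroup (X × ℕ) ⋊[actHom G X] G) := by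
  classical
  refine isSofic_of_most fun W ε hε => ?_
  let F1 : Finset G := W.image (fun w => w.right)
  let F : Finset G := F1 ∪ Finset.image₂ (fun a b => a * b) F1 F1
  let E0 : Finset X := W.biUnion (fun w => (w.left.toWord.map (fun x => x.1.1)).toFinset)
  let E : Finset X := Finset.image₂ (fun g x => g⁻¹ • x) F1 E0
  obtain ⟨A, hA, hA', B, φ, p, hm⟩ := hS F E ε hε
  have := Fintype.ofFinite A
  let pb : A → FreeGroup (X × ℕ) →* FreeGroup (B × ℕ) := fun a =>
    FreeGroup.map (fun x => (p a x.1, x.2))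
  let V : Finset (FreeGroup (B × ℕ)) := (Finset.univ : Finset A).biUnion fun a =>
    Finset.image₂ (fun w w' => (pb a w.left)⁻¹ * pb a w'.left) W W
  obtain ⟨Q, _, _, ρ, hρ⟩ := freeGroup_residuallyFinite_finset V
  refine ⟨A × Q, inferInstance, inferInstance, fun w =>
    { toFun := fun q => (φ w.right q.1, ρ (pb (φ w.right q.1) w.left) * q.2)
      invFun := fun q => ((φ w.right).symm q.1, (ρ (pb q.1 w.left))⁻¹ * q.2)
      left_inv := fun q => by simp
      right_inv := fun q => by simp }, ?_⟩
  refine (Most.fst (B := Q) hm).mono ?_ le_rfl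
  rintro ⟨a, q⟩ ⟨⟨hg1, hg2⟩, hp, hinj⟩
  dsimp only at hg1 hg2 hp hinj
  have hF1 : ∀ w ∈ W, w.right ∈ F1 := fun w hw => Finset.mem_image_of_mem _ hw
  have hF : ∀ w ∈ W, w.right ∈ F := fun w hw => Finset.mem_union_left _ (hF1 w hw)
  have hE0 : ∀ w ∈ W, ∀ x ∈ w.left.toWord, x.1.1 ∈ E0 := fun w hw x hx =>
    Finset.mem_biUnion.2 ⟨w, hw, List.mem_toFinset.2 (List.mem_map.2 ⟨x, hx, rfl⟩)⟩
  have hp1 : ∀ w ∈ W, ∀ x ∈ E0, w.right⁻¹ • x ∈ E ∧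
      p (φ w.right a) x = p a (w.right⁻¹ • x) := by
    intro w hw x hx
    have hm : w.right⁻¹ • x ∈ E := Finset.mem_image₂_of_mem (hF1 w hw) hx
    refine ⟨hm, ?_⟩
    have := hp _ (hF w hw) _ hm
    rwa [smul_inv_smul] at this
  refine ⟨fun w hw w' hw' => ?_, fun w hw w' hw' e => ?_⟩
  · have e1 : φ (w.right * w'.right) a = φ w.right (φ w'.right a) :=
      hg1 _ (hF w hw) _ (hF w' hw')
    have e2 : pb (φ (w.right * w'.right) a) (actHom G X w.right w'.left)
        = pb (φ w'.right a) w'.left := by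
      rw [actHom_apply]
      simp only [pb]
      rw [FreeGroup.map.comp]
      apply freeGroup_map_congr
      intro x hx
      obtain ⟨h1, h2⟩ := hp1 w' hw' _ (hE0 w' hw' x hx)
      have h3 := hp (w.right * w'.right) (Finset.mem_union_right _
        (Finset.mem_image₂_of_mem (hF1 w hw) (hF1 w' hw'))) _ h1
      rw [mul_smul, smul_inv_smul] at h3
      simp only [Function.comp_apply]
      rw [h3, h2]
    simp only [Equiv.coe_fn_mk, SemidirectProduct.mul_left, SemidirectProduct.mul_right, map_mul]
    rw [e2, e1, mul_assoc]
  · simp only [Equiv.coe_fn_mk, Prod.mk.injEq] at e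
    obtain ⟨e1, e2⟩ := e
    have hr : w.right = w'.right := hg2 _ (hF w hw) _ (hF w' hw') e1
    rw [← hr] at e2
    have e3 := mul_right_cancel e2
    have e4 : pb (φ w.right a) w.left = pb (φ w.right a) w'.left := by
      by_contra hne
      refine hρ ((pb (φ w.right a) w.left)⁻¹ * pb (φ w.right a) w'.left)
        (Finset.mem_biUnion.2 ⟨_, Finset.mem_univ _, Finset.mem_image₂_of_mem hw hw'⟩) ?_ ?_
      · intro h; exact hne (inv_mul_eq_one.1 h)
      · rw [map_mul, map_inv, e3, inv_mul_cancel]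
    refine SemidirectProduct.ext ?_ hr
    refine freeGroup_map_injOn _ _ _ {x | x.1 ∈ E0} ?_ (hE0 w hw) (hE0 w' hw') e4
    rintro ⟨x, n⟩ hx ⟨y, m⟩ hy hxy
    simp only [Prod.mk.injEq] at hxy
    obtain ⟨hx1, hx2⟩ := hp1 w hw x hx
    obtain ⟨hy1, hy2⟩ := hp1 w hw y hy
    have := hinj hx1 hy1 (by rw [← hx2, ← hy2, hxy.1])
    rw [smul_left_cancel _ this, hxy.2]

section Embedding

variable {G : Type*} [Group G] (H : Subgroup G)

/-- The letters of the free part of a word. -/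
def letterList : List (Σ _ : ℕ, G) → List (((G ⧸ H) × ℕ) × Bool)
  | [] => []
  | ⟨n, g⟩ :: l => ((((1 : G) : G ⧸ H), n), true) :: (((g : G ⧸ H), n), false) ::
      (letterList l).map (fun x => ((g • x.1.1, x.1.2), x.2))

/-- The image of a copy of `G`. -/
def copyHom (n : ℕ) : G →* FreeGroup ((G ⧸ H) × ℕ) ⋊[actHom G (G ⧸ H)] G :=
  (MulAut.conj (SemidirectProduct.inl (FreeGroup.of (((1 : G) : G ⧸ H), n)))).toMonoidHom.comp
    SemidirectProduct.inr

theorem copyHom_left (n : ℕ) (g : G) : (copyHom H n g).left =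
    FreeGroup.mk [((((1 : G) : G ⧸ H), n), true), (((g : G ⧸ H), n), false)] := by
  simp [copyHom, actHom_apply, FreeGroup.of, SemidirectProduct.mul_left]
  have : g • ((1 : G) : G ⧸ H) = g := by
    rw [MulAction.Quotient.smul_coe, smul_eq_mul, mul_one]
  simp [FreeGroup.invRev, this]

theorem copyHom_right (n : ℕ) (g : G) : (copyHom H n g).right = g := by
  simp [copyHom]

theorem copyHom_prod_left (l : List (Σ _ : ℕ, G)) :
    ((l.map (fun x => copyHom H x.1 x.2)).prod).left = FreeGroup.mk (letterList H l) := by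
  induction l with
  | nil => rfl
  | cons x l ih =>
    obtain ⟨n, g⟩ := x
    rw [List.map_cons, List.prod_cons, SemidirectProduct.mul_left, ih, copyHom_left,
      copyHom_right, actHom_apply, FreeGroup.map.mk, FreeGroup.mul_mk]
    rfl

theorem letterList_reduced (l : List (Σ _ : ℕ, G)) (hl : ∀ x ∈ l, x.2 ∉ H)
    (hc : l.IsChain fun x y => x.1 ≠ y.1) : FreeGroup.IsReduced (letterList H l) := by
  induction l with
  | nil => exact List.isChain_nil
  | cons x l ih =>
    obtain ⟨n, g⟩ := x
    have hg : g ∉ H := hl ⟨n, g⟩ List.mem_cons_self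
    have ih' := ih (fun x hx => hl x (List.mem_cons_of_mem _ hx)) hc.tail
    unfold FreeGroup.IsReduced at *
    rw [letterList, List.isChain_cons_cons]
    refine ⟨?_, ?_⟩
    · intro h
      exfalso
      simp only [Prod.mk.injEq, and_true] at h
      have := QuotientGroup.eq.1 h
      simp at this
      exact hg this
    · rw [List.isChain_cons]
      refine ⟨?_, ?_⟩
      · intro y hy h
        exfalso
        cases l with
        | nil => simp [letterList] at hy
        | cons z l =>
          obtain ⟨m, g'⟩ := z
          simp [letterList] at hy
          rw [List.isChain_cons_cons] at hc
          apply hc.1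
          rw [← hy] at h
          exact (Prod.mk.inj h).2
      · rw [List.isChain_map]
        refine ih'.imp ?_
        intro a b hab h
        apply hab
        simp only [Prod.mk.injEq] at h
        exact Prod.ext (smul_left_cancel _ h.1) h.2

theorem pushoutI_embeds : ∃ f : Monoid.PushoutI (fun _ : ℕ => H.subtype) →*
    FreeGroup ((G ⧸ H) × ℕ) ⋊[actHom G (G ⧸ H)] G, Function.Injective f := by
  classical
  let f : Monoid.PushoutI (fun _ : ℕ => H.subtype) →*
    FreeGroup ((G ⧸ H) × ℕ) ⋊[actHom G (G ⧸ H)] G :=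
    Monoid.PushoutI.lift (copyHom H) (SemidirectProduct.inr.comp H.subtype) (by
      intro n
      ext h
      · simp only [MonoidHom.comp_apply, Subgroup.coe_subtype, copyHom_left,
          SemidirectProduct.left_inr]
        have : ((h : G) : G ⧸ H) = ((1 : G) : G ⧸ H) := by
          rw [QuotientGroup.eq]; simp
        rw [this]
        exact mul_inv_cancel (FreeGroup.of (((1 : G) : G ⧸ H), n))
      · simp [copyHom_right])
  refine ⟨f, ?_⟩
  rw [injective_iff_map_eq_one]
  intro p hp
  obtain ⟨d⟩ := Monoid.PushoutI.NormalWord.transversal_nonempty (fun _ : ℕ => H.subtype)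
    (fun _ => H.subtype_injective)
  obtain ⟨w, rfl⟩ := (Monoid.PushoutI.NormalWord.equiv (d := d)).symm.surjective p
  change f w.prod = 1 at hp
  change w.prod = 1
  have h1 : f w.prod = SemidirectProduct.inr (w.head : G) *
      (w.toList.map (fun x => copyHom H x.1 x.2)).prod := by
    rw [Monoid.PushoutI.NormalWord.prod, map_mul]
    have ha : f (Monoid.PushoutI.base _ w.head) = SemidirectProduct.inr (w.head : G) := by
      simp [f]
    have hb : f (Monoid.PushoutI.ofCoprodI w.toWord.prod) =
        (w.toList.map (fun x => copyHom H x.1 x.2)).prod := by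
      rw [Monoid.CoprodI.Word.prod, map_list_prod, map_list_prod, List.map_map, List.map_map]
      congr 1
    rw [ha, hb]
  have h2 := congrArg SemidirectProduct.left h1
  rw [hp] at h2
  simp only [SemidirectProduct.one_left, SemidirectProduct.mul_left, SemidirectProduct.left_inr,
    one_mul, copyHom_prod_left, SemidirectProduct.right_inr] at h2
  have h3 : FreeGroup.mk (letterList H w.toList) = 1 := by
    exact (EmbeddingLike.map_eq_one_iff.1 h2.symm)
  have hr := letterList_reduced H w.toList ?_ w.chain_ne
  · have h4 : letterList H w.toList = [] := by
      rw [← hr.reduce_eq, ← FreeGroup.toWord_mk, h3, FreeGroup.toWord_one]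
    have h5 : w.toList = [] := by
      cases h : w.toList with
      | nil => rfl
      | cons x l => rw [h] at h4; simp [letterList] at h4
    rw [hp, h5] at h1
    have h6 := congrArg SemidirectProduct.right h1
    simp at h6
    have h7 : w = Monoid.PushoutI.NormalWord.empty := by
      apply Monoid.PushoutI.NormalWord.ext
      · exact Subtype.ext h6.symm
      · exact h5
    rw [h7, Monoid.PushoutI.NormalWord.prod_empty]
  · rintro ⟨n, g⟩ hx hgH
    have hs := w.normalized n g hx
    apply w.ne_one _ hx
    have hc := (d.compl n).1
    have hg' : g ∈ (H.subtype).range := by simpa using hgH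
    have := @hc (⟨g, hg'⟩, ⟨1, d.one_mem n⟩) (⟨1, one_mem _⟩, ⟨g, hs⟩) (by simp)
    simp only [Prod.mk.injEq, Subtype.mk.injEq] at this
    exact this.1

end Embedding

theorem isAmenable_prod_bot {G K : Type*} [Group G] [Group K] (M : Subgroup G)
    (hM : IsAmenable M) : IsAmenable (M.prod (⊥ : Subgroup K)) := by
  refine hM.of_surjective (((MonoidHom.inl G K).comp M.subtype).codRestrict _ ?_) ?_
  · intro x
    exact ⟨x.2, one_mem _⟩
  · rintro ⟨⟨x, y⟩, hx, hy⟩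
    refine ⟨⟨x, hx⟩, ?_⟩
    apply Subtype.ext
    have : y = 1 := hy
    subst this
    rfl

theorem isAmenable_map_mk {G : Type*} [Group G] (N M : Subgroup G) [N.Normal]
    (hM : IsAmenable (M ⧸ N.subgroupOf M)) :
    IsAmenable (M.map (QuotientGroup.mk' N)) := by
  let f : M →* M.map (QuotientGroup.mk' N) := (QuotientGroup.mk' N).subgroupMap M
  have hf : Function.Surjective f := (QuotientGroup.mk' N).subgroupMap_surjective M
  refine hM.of_surjective (QuotientGroup.lift (N.subgroupOf M) f ?_) ?_
  · intro x hx
    apply Subtype.ext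
    exact (QuotientGroup.eq_one_iff (N := N) (x : G)).2 hx
  · exact QuotientGroup.lift_surjective_of_surjective _ _ hf _

theorem core_of_sigmaCoSofic {G : Type u} [Group G] [Countable G] (H : Subgroup G)
    (h : SigmaCoSofic H) :
    ∃ (K : ℕ → Type u) (_ : ∀ i, Group (K i)) (M : ∀ i, Subgroup (K i))
      (ψ : ∀ i, G × Multiplicative ℤ → K i),
      (∀ i, IsSofic (K i)) ∧ (∀ i, IsAmenable (M i)) ∧
      (∀ g h, ∀ᶠ i in Filter.atTop, ψ i (g * h) = ψ i g * ψ i h) ∧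
      (∀ g, ∀ᶠ i in Filter.atTop,
        (ψ i g ∈ M i ↔ g ∈ H.prod (⊥ : Subgroup (Multiplicative ℤ)))) := by
  classical
  obtain ⟨Gn, Hn, hGm, hHm, hG, hH, hle, hco⟩ := h
  obtain ⟨e, he⟩ := exists_surjective_nat G
  let W : ∀ n, CoSoficWitness ((Hn n).subgroupOf (Gn n)) := fun n => (hco n).some
  have hj : ∀ n, ∃ j, ∀ k < n, ∀ hk : e k ∈ Gn n, e k ∉ Hn n → (⟨e k, hk⟩ : Gn n) ∉ (W n).Gi j := by
    intro n
    have h1 : ∀ k, ∃ j, ∀ hk : e k ∈ Gn n, e k ∉ Hn n → (⟨e k, hk⟩ : Gn n) ∉ (W n).Gi j := by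
      intro k
      by_contra hcon
      push Not at hcon
      obtain ⟨hk, hk', -⟩ := hcon 0
      apply hk'
      have : (⟨e k, hk⟩ : Gn n) ∈ (Hn n).subgroupOf (Gn n) := by
        rw [← (W n).iInf_eq, Subgroup.mem_iInf]
        intro j
        exact (hcon j).2.2
      exact this
    choose j hj using h1
    refine ⟨(Finset.range n).sup j, fun k hk hk1 hk2 hmem => ?_⟩
    exact hj k hk1 hk2 ((W n).antitone_G (Finset.le_sup (Finset.mem_range.2 hk)) hmem)
  choose j hj using hj
  have hnorm : ∀ n, ((W n).Hi (j n)).Normal := fun n => (W n).normal (j n)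
  have hGev : ∀ g, ∀ᶠ n in Filter.atTop, g ∈ Gn n := by
    intro g
    have : g ∈ ⨆ i, Gn i := by rw [hG]; trivial
    rw [Subgroup.mem_iSup_of_directed hGm.directed_le] at this
    obtain ⟨i, hi⟩ := this
    filter_upwards [Filter.eventually_ge_atTop i] with n hn
    exact hGm hn hi
  have hHev : ∀ g ∈ H, ∀ᶠ n in Filter.atTop, g ∈ Hn n := by
    intro g hg
    rw [← hH, Subgroup.mem_iSup_of_directed hHm.directed_le] at hg
    obtain ⟨i, hi⟩ := hg
    filter_upwards [Filter.eventually_ge_atTop i] with n hn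
    exact hHm hn hi
  have hHle : ∀ n, Hn n ≤ H := fun n => hH ▸ le_iSup Hn n
  let ψ0 : ∀ n, G → (Gn n) ⧸ ((W n).Hi (j n)) := fun n g =>
    if hg : g ∈ Gn n then QuotientGroup.mk ⟨g, hg⟩ else 1
  have hψ : ∀ n g (hg : g ∈ Gn n), ψ0 n g = QuotientGroup.mk' _ (⟨g, hg⟩ : Gn n) := by
    intro n g hg
    simp [ψ0, hg]
  refine ⟨fun n => ((Gn n) ⧸ ((W n).Hi (j n))) × Multiplicative ℤ, fun n => inferInstance,
    fun n => (((W n).Gi (j n)).map (QuotientGroup.mk' ((W n).Hi (j n)))).prod ⊥,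
    fun n g => (ψ0 n g.1, g.2), fun n => ((W n).sofic (j n)).prod isSofic_int, fun n => ?_, ?_, ?_⟩
  · exact isAmenable_prod_bot _ (isAmenable_map_mk _ _ ((W n).amenable (j n)))
  · rintro ⟨g, a⟩ ⟨h, b⟩
    filter_upwards [hGev g, hGev h] with n hg hh
    rw [Prod.mk_mul_mk, Prod.mk_mul_mk]
    simp only
    rw [hψ n g hg, hψ n h hh, hψ n (g * h) (mul_mem hg hh), ← map_mul]
    rfl
  · rintro ⟨g, a⟩
    have key : ∀ᶠ n in Filter.atTop,
        (ψ0 n g ∈ ((W n).Gi (j n)).map (QuotientGroup.mk' ((W n).Hi (j n))) ↔ g ∈ H) := by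
      have hmem : ∀ n (hg : g ∈ Gn n),
          (ψ0 n g ∈ ((W n).Gi (j n)).map (QuotientGroup.mk' ((W n).Hi (j n))) ↔
            (⟨g, hg⟩ : Gn n) ∈ (W n).Gi (j n)) := by
        intro n hg
        rw [hψ n g hg, ← Subgroup.mem_comap, Subgroup.comap_map_eq, QuotientGroup.ker_mk',
          sup_eq_left.2 ((W n).le (j n))]
      by_cases hgH : g ∈ H
      · filter_upwards [hHev g hgH, hGev g] with n h1 h2
        rw [hmem n h2]
        refine iff_of_true ?_ hgH
        have : (⟨g, h2⟩ : Gn n) ∈ (Hn n).subgroupOf (Gn n) := h1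
        rw [← (W n).iInf_eq, Subgroup.mem_iInf] at this
        exact this _
      · obtain ⟨k, rfl⟩ := he g
        filter_upwards [hGev (e k), Filter.eventually_gt_atTop k] with n h2 h3
        rw [hmem n h2]
        exact iff_of_false (hj n k h3 h2 (fun h => hgH (hHle n h))) hgH
    filter_upwards [key] with n hn
    rw [Subgroup.mem_prod, Subgroup.mem_prod, hn]

/-- If `G` is a countable sofic group and `H` is σ-co-sofic in `G`, then, identifying `H`
with `H × {0} ≤ G × ℤ`, the pair `H < G × ℤ` is relatively sofic over `G × ℤ`, and the
amalgamated free product of countably infinitely many copies of `G × ℤ` over `H`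
is sofic. -/
theorem relativelySofic_and_isSofic_pushoutI_prod_int {G : Type u} [Group G] [Countable G]
    (hG : IsSofic G) (H : Subgroup G) (h : SigmaCoSofic H) :
    RelativelySofic.{u}
        (H.prod (⊥ : Subgroup (Multiplicative ℤ))) (G × Multiplicative ℤ) ∧
      IsSofic (Monoid.PushoutI
        (fun _ : ℕ => (H.prod (⊥ : Subgroup (Multiplicative ℤ))).subtype)) := by
  classical
  obtain ⟨K, iK, M, ψ, hK, hM, h1, h2⟩ := core_of_sigmaCoSofic H h
  refine ⟨?_, ?_⟩
  · have hω : ((Filter.hyperfilter ℕ : Ultrafilter ℕ) : Filter ℕ) ≤ Filter.atTop :=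
      Nat.hyperfilter_le_atTop
    have hmk : ∀ (f f' : ∀ i, K i × (G × Multiplicative ℤ)),
        (QuotientGroup.mk' (upKer (Filter.hyperfilter ℕ) _) f =
          QuotientGroup.mk' (upKer (Filter.hyperfilter ℕ) _) f' ↔
        ∀ᶠ i in (Filter.hyperfilter ℕ : Filter ℕ), f i = f' i) := by
      intro f f'
      rw [QuotientGroup.mk'_apply, QuotientGroup.mk'_apply, QuotientGroup.eq]
      change (∀ᶠ i in (Filter.hyperfilter ℕ : Filter ℕ), (f⁻¹ * f') i = 1) ↔ _
      refine Filter.eventually_congr (Filter.Eventually.of_forall fun i => ?_)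
      exact inv_mul_eq_one
    let π : G × Multiplicative ℤ →*
        Ultraproduct (Filter.hyperfilter ℕ) (fun i => K i × (G × Multiplicative ℤ)) :=
      MonoidHom.mk' (fun g => QuotientGroup.mk' (upKer (Filter.hyperfilter ℕ)
        (fun i => K i × (G × Multiplicative ℤ))) (fun i => (ψ i g, g))) (by
        intro g g'
        refine Eq.trans ?_ (map_mul (QuotientGroup.mk' (upKer (Filter.hyperfilter ℕ)
          (fun i => K i × (G × Multiplicative ℤ)))) _ _)
        refine (hmk _ _).2 ?_
        filter_upwards [hω (h1 g g')] with i hi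
        exact Prod.ext hi rfl)
    have hπ : ∀ g, π g = QuotientGroup.mk' (upKer (Filter.hyperfilter ℕ)
        (fun i => K i × (G × Multiplicative ℤ))) (fun i => (ψ i g, g)) := fun g => rfl
    refine ⟨⟨K, M, Filter.hyperfilter ℕ, fun s hs => Filter.notMem_hyperfilter_of_finite hs,
      hK, hM, π, ?_, ?_⟩⟩
    · intro g g' hgg
      obtain ⟨i, hi⟩ := ((hmk _ _).1 hgg).exists
      exact (Prod.mk.inj hi).2
    · ext x
      constructor
      · rintro ⟨⟨g, -, rfl⟩, f, hf, hfg⟩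
        refine ⟨g, ?_, rfl⟩
        rw [hπ] at hfg
        have h3 := (hmk _ _).1 hfg
        obtain ⟨i, hi, hi2⟩ := (h3.and (hω (h2 g))).exists
        have h4 := (hf i (Set.mem_univ i)).1
        rw [hi] at h4
        exact hi2.1 h4
      · rintro ⟨g, hg, rfl⟩
        refine ⟨⟨g, trivial, rfl⟩, fun i => if ψ i g ∈ M i then (ψ i g, g) else 1, ?_, ?_⟩
        · intro i _
          dsimp only
          split_ifs with hi
          · exact ⟨hi, trivial⟩
          · exact ((M i).prod ⊤).one_mem
        · rw [hπ]
          refine (hmk _ _).2 ?_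
          filter_upwards [hω (h2 g)] with i hi
          rw [if_pos (hi.2 hg)]
  · obtain ⟨f, hf⟩ := pushoutI_embeds (H.prod (⊥ : Subgroup (Multiplicative ℤ)))
    exact IsSofic.of_injective (isSofic_semidirect
      (soficAction_coset (hG.prod isSofic_int) _ M hK hM ψ h1 h2)) f hf
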